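/- Let I ⊆ ℝ be an interval, f : ℝ → ℝ convex on I and continuous on the segment joining a and b, where a, b ∈ I. Then f((a+b)/2) ≤ ∫₀¹ f((1-t)a + tb) dt ≤ ∫₀¹ (∫₀¹ f((1-t)a + tb)·(λ/(1-λ))·t^((2λ-1)/(1-λ)) dt) dλ ≤ (f(a)+f(b))/2. -/

import Mathlib

open MeasureTheory Set

/-- The density of the measure `η_λ` on `[0, 1]`, as a function of `λ` and `t`. -/
noncomputable def hermiteWeight (l t : ℝ) : ℝ := l / (1 - l) * t ^ ((2 * l - 1) / (1 - l))

theorem measurable_hermiteWeight : Measurable fun p : ℝ × ℝ => hermiteWeight p.1 p.2 := by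
  unfold hermiteWeight
  fun_prop

theorem hermiteWeight_nonneg {l t : ℝ} (hl : l ∈ Ioo (0 : ℝ) 1) (ht : 0 ≤ t) :
    0 ≤ hermiteWeight l t :=
  mul_nonneg (div_nonneg hl.1.le (sub_nonneg.2 hl.2.le)) (Real.rpow_nonneg ht _)

theorem hermiteWeight_half (t : ℝ) : hermiteWeight (1 / 2) t = 1 := by
  norm_num [hermiteWeight]

theorem neg_one_lt_hermiteWeight_exponent {l : ℝ} (hl : l ∈ Ioo (0 : ℝ) 1) :
    -1 < (2 * l - 1) / (1 - l) := by
  have h : 0 < 1 - l := sub_pos.2 hl.2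
  rw [lt_div_iff₀ h]
  linarith [hl.1]

theorem intervalIntegrable_hermiteWeight {l : ℝ} (hl : l ∈ Ioo (0 : ℝ) 1) :
    IntervalIntegrable (hermiteWeight l) volume 0 1 :=
  (intervalIntegral.intervalIntegrable_rpow'
    (neg_one_lt_hermiteWeight_exponent hl)).const_mul _

theorem integral_hermiteWeight {l : ℝ} (hl : l ∈ Ioo (0 : ℝ) 1) :
    ∫ t in (0 : ℝ)..1, hermiteWeight l t = 1 := by
  have h : 1 - l ≠ 0 := (sub_pos.2 hl.2).ne'
  have h0 : l ≠ 0 := hl.1.ne'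
  have e : (2 * l - 1) / (1 - l) + 1 = l / (1 - l) := by field_simp; ring
  unfold hermiteWeight
  rw [intervalIntegral.integral_const_mul,
    integral_rpow (.inl (neg_one_lt_hermiteWeight_exponent hl)), e,
    Real.one_rpow, Real.zero_rpow (div_ne_zero h0 h)]
  field_simp
  simp

theorem integral_id_mul_hermiteWeight {l : ℝ} (hl : l ∈ Ioo (0 : ℝ) 1) :
    ∫ t in (0 : ℝ)..1, t * hermiteWeight l t = l := by
  have h : 0 < 1 - l := sub_pos.2 hl.2
  have h' : 1 - l ≠ 0 := h.ne'
  have e : (2 * l - 1) / (1 - l) + 1 = l / (1 - l) := by field_simp; ring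
  have e' : l / (1 - l) + 1 = 1 / (1 - l) := by field_simp; ring
  have hc : 0 < l / (1 - l) := div_pos hl.1 h
  have hcongr : ∫ t in (0 : ℝ)..1, t * hermiteWeight l t =
      ∫ t in (0 : ℝ)..1, l / (1 - l) * t ^ (l / (1 - l)) := by
    refine intervalIntegral.integral_congr_Ioo_of_le zero_le_one fun t ht => ?_
    simp only [hermiteWeight]
    rw [← e, Real.rpow_add_one ht.1.ne']
    ring
  rw [hcongr, intervalIntegral.integral_const_mul, integral_rpow (.inl (by linarith)), e',
    Real.one_rpow, Real.zero_rpow (one_div_ne_zero h')]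
  field_simp
  simp

theorem integral_affine_mul_hermiteWeight {l : ℝ} (hl : l ∈ Ioo (0 : ℝ) 1) (p q : ℝ) :
    ∫ t in (0 : ℝ)..1, (p + q * t) * hermiteWeight l t = p + q * l := by
  have hW := intervalIntegrable_hermiteWeight hl
  have hW' : IntervalIntegrable (fun t => t * hermiteWeight l t) volume 0 1 :=
    hW.continuousOn_mul continuousOn_id
  simp only [add_mul, mul_assoc]
  rw [intervalIntegral.integral_add (hW.const_mul p) (hW'.const_mul q),
    intervalIntegral.integral_const_mul, intervalIntegral.integral_const_mul,
    integral_hermiteWeight hl, integral_id_mul_hermiteWeight hl, mul_one]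

theorem ConvexOn.exists_affine_le_of_mem_interior {S : Set ℝ} {g : ℝ → ℝ}
    (hg : ConvexOn ℝ S g) {x : ℝ} (hx : x ∈ interior S) :
    ∃ m : ℝ, ∀ t ∈ S, g x + m * (t - x) ≤ g t := by
  refine ⟨derivWithin g (Ioi x) x, fun t ht => ?_⟩
  rcases lt_trichotomy t x with h | rfl | h
  · have h1 := (hg.slope_le_leftDeriv_of_mem_interior ht hx h).trans
      (hg.leftDeriv_le_rightDeriv_of_mem_interior hx)
    rw [slope_def_field, div_le_iff₀ (sub_pos.2 h)] at h1
    linarith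
  · simp
  · have h1 := hg.rightDeriv_le_slope_of_mem_interior hx ht h
    rw [slope_def_field, le_div_iff₀ (sub_pos.2 h)] at h1
    linarith

section

variable {g : ℝ → ℝ}

theorem intervalIntegrable_mul_hermiteWeight (hc : ContinuousOn g (Icc 0 1)) {l : ℝ}
    (hl : l ∈ Ioo (0 : ℝ) 1) :
    IntervalIntegrable (fun t => g t * hermiteWeight l t) volume 0 1 :=
  (intervalIntegrable_hermiteWeight hl).continuousOn_mul (by rwa [uIcc_of_le zero_le_one])

theorem ConvexOn.le_integral_mul_hermiteWeight (hg : ConvexOn ℝ (Icc 0 1) g)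
    (hc : ContinuousOn g (Icc 0 1)) {l : ℝ} (hl : l ∈ Ioo (0 : ℝ) 1) :
    g l ≤ ∫ t in (0 : ℝ)..1, g t * hermiteWeight l t := by
  obtain ⟨m, hm⟩ := hg.exists_affine_le_of_mem_interior (x := l) (by rwa [interior_Icc])
  have hi := integral_affine_mul_hermiteWeight hl (g l - m * l) m
  rw [sub_add_cancel] at hi
  rw [← hi]
  refine intervalIntegral.integral_mono_on zero_le_one
    (intervalIntegrable_mul_hermiteWeight (by fun_prop) hl)
    (intervalIntegrable_mul_hermiteWeight hc hl) fun t ht => ?_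
  exact mul_le_mul_of_nonneg_right (by linarith [hm t ht]) (hermiteWeight_nonneg hl ht.1)

theorem ConvexOn.integral_mul_hermiteWeight_le (hg : ConvexOn ℝ (Icc 0 1) g)
    (hc : ContinuousOn g (Icc 0 1)) {l : ℝ} (hl : l ∈ Ioo (0 : ℝ) 1) :
    ∫ t in (0 : ℝ)..1, g t * hermiteWeight l t ≤ g 0 + (g 1 - g 0) * l := by
  rw [← integral_affine_mul_hermiteWeight hl]
  refine intervalIntegral.integral_mono_on zero_le_one
    (intervalIntegrable_mul_hermiteWeight hc hl)
    (intervalIntegrable_mul_hermiteWeight (by fun_prop) hl) fun t ht => ?_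
  refine mul_le_mul_of_nonneg_right ?_ (hermiteWeight_nonneg hl ht.1)
  have h := hg.2 (left_mem_Icc.2 zero_le_one) (right_mem_Icc.2 zero_le_one)
    (sub_nonneg.2 ht.2) ht.1 (sub_add_cancel 1 t)
  simp only [smul_eq_mul, mul_zero, mul_one, zero_add] at h
  linarith

theorem stronglyMeasurable_integral_mul_hermiteWeight (hc : ContinuousOn g (Icc 0 1)) :
    StronglyMeasurable fun l => ∫ t in (0 : ℝ)..1, g t * hermiteWeight l t := by
  have hG : Continuous (IccExtend (zero_le_one' ℝ) ((Icc 0 1).domRestrict g)) :=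
    (continuousOn_iff_continuous_domRestrict.1 hc).Icc_extend'
  have heq : (fun l => ∫ t in (0 : ℝ)..1, g t * hermiteWeight l t) = fun l =>
      ∫ t in Ioc (0 : ℝ) 1,
        IccExtend (zero_le_one' ℝ) ((Icc 0 1).domRestrict g) t * hermiteWeight l t := by
    funext l
    rw [intervalIntegral.integral_of_le zero_le_one]
    refine setIntegral_congr_fun measurableSet_Ioc fun t ht => ?_
    simp only [IccExtend_of_mem _ _ (Ioc_subset_Icc_self ht), domRestrict_apply]
  rw [heq]
  exact StronglyMeasurable.integral_prod_right (f := fun l t =>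
      IccExtend (zero_le_one' ℝ) ((Icc 0 1).domRestrict g) t * hermiteWeight l t)
    ((hG.measurable.comp measurable_snd).mul measurable_hermiteWeight).stronglyMeasurable

theorem ConvexOn.intervalIntegrable_integral_mul_hermiteWeight (hg : ConvexOn ℝ (Icc 0 1) g)
    (hc : ContinuousOn g (Icc 0 1)) :
    IntervalIntegrable (fun l => ∫ t in (0 : ℝ)..1, g t * hermiteWeight l t) volume 0 1 := by
  have hgi : IntegrableOn g (Ioo 0 1) :=
    hc.integrableOn_Icc.mono_set Ioo_subset_Icc_self
  have hai : IntegrableOn (fun l => g 0 + (g 1 - g 0) * l) (Ioo 0 1) :=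
    (Continuous.integrableOn_Icc (by fun_prop)).mono_set Ioo_subset_Icc_self
  rw [intervalIntegrable_iff_integrableOn_Ioo_of_le zero_le_one]
  exact integrable_of_le_of_le
    (stronglyMeasurable_integral_mul_hermiteWeight hc).aestronglyMeasurable
    (ae_restrict_of_forall_mem measurableSet_Ioo fun l hl =>
      hg.le_integral_mul_hermiteWeight hc hl)
    (ae_restrict_of_forall_mem measurableSet_Ioo fun l hl =>
      hg.integral_mul_hermiteWeight_le hc hl) hgi hai

/-- The Hermite–Hadamard inequality on `[0, 1]`, refined by averaging over the weights. -/
theorem ConvexOn.hermite_hadamard_averaged (hg : ConvexOn ℝ (Icc 0 1) g)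
    (hc : ContinuousOn g (Icc 0 1)) :
    g (1 / 2) ≤ (∫ t in (0 : ℝ)..1, g t) ∧
    (∫ t in (0 : ℝ)..1, g t) ≤
      (∫ l in (0 : ℝ)..1, ∫ t in (0 : ℝ)..1, g t * hermiteWeight l t) ∧
    (∫ l in (0 : ℝ)..1, ∫ t in (0 : ℝ)..1, g t * hermiteWeight l t) ≤ (g 0 + g 1) / 2 := by
  have hG := hg.intervalIntegrable_integral_mul_hermiteWeight hc
  refine ⟨?_, ?_, ?_⟩
  · have h := hg.le_integral_mul_hermiteWeight hc (l := 1 / 2) (by norm_num)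
    simpa only [hermiteWeight_half, mul_one] using h
  · exact intervalIntegral.integral_mono_on_of_le_Ioo zero_le_one
      (hc.intervalIntegrable_of_Icc zero_le_one) hG
      fun l hl => hg.le_integral_mul_hermiteWeight hc hl
  · have hi : ∫ l in (0 : ℝ)..1, (g 0 + (g 1 - g 0) * l) = (g 0 + g 1) / 2 := by
      rw [intervalIntegral.integral_add (by simp)
        (Continuous.intervalIntegrable (by fun_prop) _ _),
        intervalIntegral.integral_const_mul, integral_id, intervalIntegral.integral_const]
      simp only [smul_eq_mul]
      ring
    rw [← hi]
    exact intervalIntegral.integral_mono_on_of_le_Ioo zero_le_one hG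
      (Continuous.intervalIntegrable (by fun_prop) _ _)
      fun l hl => hg.integral_mul_hermiteWeight_le hc hl

end

/-- Scalar refinement of the Hermite–Hadamard inequality obtained by averaging the
weighted Hermite–Hadamard inequality over the weight `λ ∈ (0,1)`. -/
theorem stmt_4 (I : Set ℝ) (hI : Convex ℝ I) (f : ℝ → ℝ) (hf : ConvexOn ℝ I f)
    (a b : ℝ) (ha : a ∈ I) (hb : b ∈ I) (hcont : ContinuousOn f (segment ℝ a b)) :
    f ((a + b) / 2) ≤ (∫ t in (0 : ℝ)..1, f ((1 - t) * a + t * b)) ∧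
    (∫ t in (0 : ℝ)..1, f ((1 - t) * a + t * b)) ≤
      (∫ l in (0 : ℝ)..1, ∫ t in (0 : ℝ)..1,
        f ((1 - t) * a + t * b) * (l / (1 - l) * t ^ ((2 * l - 1) / (1 - l)))) ∧
    (∫ l in (0 : ℝ)..1, ∫ t in (0 : ℝ)..1,
        f ((1 - t) * a + t * b) * (l / (1 - l) * t ^ ((2 * l - 1) / (1 - l)))) ≤
      (f a + f b) / 2 := by
  have hmem : ∀ t ∈ Set.Icc (0 : ℝ) 1, (1 - t) * a + t * b ∈ segment ℝ a b := fun t ht =>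
    ⟨1 - t, t, sub_nonneg.2 ht.2, ht.1, sub_add_cancel 1 t, rfl⟩
  have hline : ∀ t : ℝ, AffineMap.lineMap a b t = (1 - t) * a + t * b := fun t => by
    rw [AffineMap.lineMap_apply_ring]
  have hg : ConvexOn ℝ (Set.Icc 0 1) fun t => f ((1 - t) * a + t * b) := by
    have h := (hf.comp_affineMap (AffineMap.lineMap a b)).subset (s := Set.Icc (0 : ℝ) 1)
      (fun t ht => by
        rw [Set.mem_preimage, hline]
        exact hI.segment_subset ha hb (hmem t ht)) (convex_Icc 0 1)
    simpa only [Function.comp_def, hline] using h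
  have hc : ContinuousOn (fun t => f ((1 - t) * a + t * b)) (Set.Icc 0 1) :=
    hcont.comp (by fun_prop) hmem
  have h := hg.hermite_hadamard_averaged hc
  have hmid : (1 - 1 / 2) * a + 1 / 2 * b = (a + b) / 2 := by ring
  simpa only [hermiteWeight, hmid, sub_zero, sub_self, one_mul, zero_mul, add_zero, zero_add]
    using h
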